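/- Under the stated hypotheses on Φ and f, the partial derivative of the component X3 with respect to y3 vanishes at the origin: X3_{y3}(0) = 0. -/

import Mathlib

noncomputable section

/-- The model space `ℝ^13` with coordinates
`(t, x0, y0, x1, y1, x2, y2, x3, y3, x4, y4, x5, y5)`
indexed by `0, 1, ..., 12` respectively. -/
abbrev E13 := Fin 13 → ℝ

/-- The constant coordinate vector field `∂_u` of the `i`-th coordinate. -/
def e (i : Fin 13) : E13 := Pi.single i 1

/-- Partial derivative of a scalar function `F` in the `i`-th coordinate
direction, at a point `p`. -/
def pd (F : E13 → ℝ) (i : Fin 13) (p : E13) : ℝ := fderiv ℝ F p (e i)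

/-- The vector field `Z''_{1,a}` of the EKR pseudo-normal form for the
singularity class 1.2.1.2.1 (at tangency points with the locus of 1.2.1.2):
`Z''_{1,a} = ∂_{x3} + (1 + y4)·∂_{y3} + x5·∂_{x4} + (a + y5)·∂_{y4}
 + x4·( ∂_{x1} + y2·∂_{y1} + (1 + x3)·∂_{x2} + y3·∂_{y2} + x2·( ∂_t + x1·∂_{x0} + y1·∂_{y0} ) )`. -/
def Z (a : ℝ) (p : E13) : E13 :=
  e 7 + (1 + p 10) • e 8 + p 11 • e 9 + (a + p 12) • e 10 +
    p 9 • (e 3 + p 6 • e 4 + (1 + p 7) • e 5 + p 8 • e 6 +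
      p 5 • (e 0 + p 3 • e 1 + p 4 • e 2))

open Filter Topology

/-- The derivative in direction `v` vanishes if the function is locally constant along the line. -/
theorem fderiv_apply_eq_zero_of_eventually_const {E : Type*} [NormedAddCommGroup E]
    [NormedSpace ℝ E] {F : E → ℝ} {x v : E} (h : ∀ᶠ s : ℝ in 𝓝 0, F (x + s • v) = F x) :
    fderiv ℝ F x v = 0 := by
  by_cases hF : DifferentiableAt ℝ F x
  · rw [← hF.lineDeriv_eq_fderiv, lineDeriv]
    have h' : (fun s : ℝ => F (x + s • v)) =ᶠ[𝓝 0] fun _ => F x := h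
    rw [h'.deriv_eq, deriv_const]
  · simp [fderiv_zero_of_not_differentiableAt hF]

/-- The derivative of a translation-invariant function is translation-invariant. -/
theorem fderiv_add_eq_of_invariant {E : Type*} [NormedAddCommGroup E] [NormedSpace ℝ E]
    {F : E → ℝ} {w : E} (h : ∀ x, F (x + w) = F x) (x : E) :
    fderiv ℝ F (x + w) = fderiv ℝ F x := by
  rw [← fderiv_comp_add_right]
  simp only [h]

theorem apply_eq_zero_of_mem_span {v : E13} (hv : v ∈ Submodule.span ℝ ({e 11, e 12} : Set E13))
    {i : Fin 13} (h11 : i ≠ 11) (h12 : i ≠ 12) : v i = 0 := by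
  obtain ⟨a, b, rfl⟩ := Submodule.mem_span_pair.1 hv
  simp [e, h11, h12]

theorem Z_plane (a s r : ℝ) :
    Z a (s • e 8 + r • e 9) = e 7 + e 8 + a • e 10 + r • (e 3 + e 5 + s • e 6) := by
  simp [Z, e]

theorem Z_apply_three (a : ℝ) (p : E13) : Z a p 3 = p 9 := by
  simp [Z, e]

theorem Z_apply_five (a : ℝ) (p : E13) : Z a p 5 = p 9 * (1 + p 7) := by
  simp [Z, e]

/-- `X3_{y3}(0) = 0`. -/
theorem lemma_X3_y3_12121 (c c' : ℝ)
    (Φ : E13 → E13) (U : Set E13) (hU : IsOpen U) (h0U : (0 : E13) ∈ U)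
    (hΦsmooth : ContDiffOn ℝ (⊤ : ℕ∞) Φ U) (hΦ0 : Φ 0 = 0)
    (hdiffeo : Function.Bijective (fderiv ℝ Φ 0))
    -- the components `T, X0, Y0` (indices 0,1,2) depend only on `t, x0, y0`
    (htri0 : ∀ p q : E13, (∀ k : Fin 13, (k : ℕ) ≤ 2 → p k = q k) →
      ∀ i : Fin 13, (i : ℕ) ≤ 2 → Φ p i = Φ q i)
    -- for `1 ≤ j ≤ 5`, the components `Xj, Yj` (indices 2j+1, 2j+2)
    -- depend only on `t, x0, y0, x1, y1, ..., xj, yj`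
    (htri : ∀ j : ℕ, 1 ≤ j → j ≤ 5 → ∀ p q : E13,
      (∀ k : Fin 13, (k : ℕ) ≤ 2 * j + 2 → p k = q k) →
      ∀ i : Fin 13, ((i : ℕ) = 2 * j + 1 ∨ (i : ℕ) = 2 * j + 2) → Φ p i = Φ q i)
    (H G : E13 → ℝ)
    (hHs : ContDiffOn ℝ (⊤ : ℕ∞) H U) (hGs : ContDiffOn ℝ (⊤ : ℕ∞) G U)
    (hH0 : H 0 ≠ 0) (hG0 : G 0 ≠ 0)
    -- `X2 = x2·H`, `X4 = x4·G`
    (hX2 : ∀ p ∈ U, Φ p 5 = p 5 * H p)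
    (hX4 : ∀ p ∈ U, Φ p 9 = p 9 * G p)
    (f : E13 → ℝ) (hfs : ContDiffOn ℝ (⊤ : ℕ∞) f U) (hf0 : f 0 ≠ 0)
    -- `dΦ(p)·Z_{1,c}(p) − f(p)·Z_{1,c'}(Φ(p)) ∈ span{∂_{x5}, ∂_{y5}}` near 0
    (hconj : ∀ p ∈ U, fderiv ℝ Φ p (Z c p) - f p • Z c' (Φ p) ∈
      Submodule.span ℝ ({e 11, e 12} : Set E13)) :
    pd (fun p => Φ p 7) 8 0 = 0 := by
  have hdiff : ∀ p ∈ U, DifferentiableAt ℝ Φ p := fun p hp =>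
    (hΦsmooth.contDiffAt (hU.mem_nhds hp)).differentiableAt (by simp)
  have hcomp : ∀ p ∈ U, ∀ i : Fin 13, i ≠ 11 → i ≠ 12 →
      fderiv ℝ (fun x => Φ x i) p (Z c p) = f p * Z c' (Φ p) i := by
    intro p hp i h11 h12
    have h := apply_eq_zero_of_mem_span (hconj p hp) h11 h12
    rw [fderiv_apply (hdiff p hp)]
    simpa [sub_eq_zero] using h
  have hinv3 : ∀ k : Fin 13, 4 < (k : ℕ) → ∀ (x : E13) (s : ℝ), Φ (x + s • e k) 3 = Φ x 3 := by
    intro k hk x s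
    refine htri 1 le_rfl (by norm_num) _ _ (fun j hj => ?_) 3 (Or.inl rfl)
    have : j ≠ k := by rintro rfl; omega
    simp [e, this]
  have hinv5 : ∀ k : Fin 13, 6 < (k : ℕ) → ∀ (x : E13) (s : ℝ), Φ (x + s • e k) 5 = Φ x 5 := by
    intro k hk x s
    refine htri 2 (by norm_num) (by norm_num) _ _ (fun j hj => ?_) 5 (Or.inl rfl)
    have : j ≠ k := by rintro rfl; omega
    simp [e, this]
  have hinv7 : ∀ (x : E13) (r : ℝ), Φ (x + r • e 9) 7 = Φ x 7 := by
    intro x r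
    refine htri 3 (by norm_num) (by norm_num) _ _ (fun j hj => ?_) 7 (Or.inl rfl)
    have : j ≠ 9 := by rintro rfl; simp at hj
    simp [e, this]
  have hd3 : ∀ k : Fin 13, 4 < (k : ℕ) → fderiv ℝ (fun x => Φ x 3) 0 (e k) = 0 := fun k hk =>
    fderiv_apply_eq_zero_of_eventually_const (Eventually.of_forall fun s => hinv3 k hk 0 s)
  have hd5 : ∀ v : E13, fderiv ℝ (fun x => Φ x 5) 0 v = H 0 * v 5 := by
    intro v
    have heq : (fun x => Φ x 5) =ᶠ[𝓝 0] fun x => x 5 * H x :=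
      eventually_of_mem (hU.mem_nhds h0U) hX2
    have hH : HasFDerivAt H (fderiv ℝ H 0) 0 :=
      ((hHs.contDiffAt (hU.mem_nhds h0U)).differentiableAt (by simp)).hasFDerivAt
    have h := ((hasFDerivAt_apply (𝕜 := ℝ) (5 : Fin 13) (0 : E13)).mul hH).fderiv
    rw [heq.fderiv_eq]
    have hv := congrArg (fun L => L v) h
    simp only [smul_apply, ContinuousLinearMap.proj_apply, Pi.zero_apply, zero_smul, zero_add,
      smul_eq_mul] at hv
    exact hv
  have htrans : ∀ i : Fin 13, (∀ k : Fin 13, 6 < (k : ℕ) → ∀ (x : E13) (s : ℝ),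
      Φ (x + s • e k) i = Φ x i) → ∀ s r : ℝ,
      fderiv ℝ (fun x => Φ x i) (s • e 8 + r • e 9) = fderiv ℝ (fun x => Φ x i) 0 := by
    intro i hi s r
    rw [fderiv_add_eq_of_invariant (fun x => hi 9 (by decide) x r), ← zero_add (s • e 8),
      fderiv_add_eq_of_invariant (fun x => hi 8 (by decide) x s)]
  set a : ℝ := fderiv ℝ (fun x => Φ x 3) 0 (e 3) with ha
  have key : ∀ s r : ℝ, r ≠ 0 → s • e 8 + r • e 9 ∈ U → H 0 = a * (1 + Φ (s • e 8) 7) := by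
    intro s r hr hp
    have hv5 : (e 7 + e 8 + c • e 10 + r • (e 3 + e 5 + s • e 6)) 5 = r := by simp [e]
    have h3 := hcomp _ hp 3 (by decide) (by decide)
    have h5 := hcomp _ hp 5 (by decide) (by decide)
    rw [htrans 3 (fun k hk => hinv3 k (by omega)), Z_plane, Z_apply_three] at h3
    rw [htrans 5 hinv5, Z_plane, Z_apply_five, hinv7, hd5, hv5] at h5
    simp only [map_add, map_smul, hd3 7 (by decide), hd3 8 (by decide), hd3 10 (by decide),
      hd3 5 (by decide), hd3 6 (by decide), ← ha, smul_eq_mul] at h3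
    refine mul_left_cancel₀ hr ?_
    linear_combination h5 - (1 + Φ (s • e 8) 7) * h3
  have hnear : ∀ᶠ s : ℝ in 𝓝 0, H 0 = a * (1 + Φ (s • e 8) 7) := by
    have hs : ∀ᶠ s : ℝ in 𝓝 0, s • e 8 ∈ U :=
      (Continuous.continuousAt (f := fun s : ℝ => s • e 8) (by fun_prop)).eventually_mem
        (by simpa using hU.mem_nhds h0U)
    filter_upwards [hs] with s hs
    have hr : ∀ᶠ r : ℝ in 𝓝 0, s • e 8 + r • e 9 ∈ U :=
      (Continuous.continuousAt (f := fun r : ℝ => s • e 8 + r • e 9) (by fun_prop)).eventually_mem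
        (by simpa using hU.mem_nhds hs)
    obtain ⟨r, hrU, hr0⟩ :=
      ((hr.filter_mono nhdsWithin_le_nhds).and (self_mem_nhdsWithin (s := {0}ᶜ))).exists
    exact key s r hr0 hrU
  have hH : H 0 = a * (1 + Φ 0 7) := by simpa using hnear.self_of_nhds
  have ha0 : a ≠ 0 := fun h => hH0 (by rw [hH, h, zero_mul])
  refine fderiv_apply_eq_zero_of_eventually_const ?_
  filter_upwards [hnear] with s hs
  rw [zero_add]
  exact add_left_cancel (mul_left_cancel₀ ha0 (hs.symm.trans hH))
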